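/- Let k ≥ 2, let λ_1, …, λ_k ∈ (0,1) with ∑_{i=1}^k λ_i = 1, and let F_1, …, F_k : ℝ^n → ℝ be measurable functions such that e^{F_i} is γ-integrable for each i and ∑_{i=1}^k λ_i F_i(x_i) ≤ (1/2)[ ∑_{i=1}^k λ_i |x_i|² − |∑_{j=1}^k λ_j x_j|² ] for all x_1, …, x_k ∈ ℝ^n. Then ∏_{i=1}^k (∫ e^{F_i} dγ)^{λ_i} ≤ 1. Equivalently, in Euclidean form: if V_1, …, V_k : ℝ^n → ℝ are measurable with e^{−V_i} Lebesgue-integrable and ∑_{i=1}^k V_i(x_i) ≥ (1/(2k)) |x_1 + ⋯ + x_k|² for all x_i ∈ ℝ^n, then ∏_{i=1}^k ∫_{ℝ^n} e^{−V_i} dx_i ≤ (2π)^{kn/2}. (No symmetry assumption on the F_i or V_i is made.) -/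

import Mathlib

open MeasureTheory Real

/-- The standard Gaussian measure on `ℝ^n`, with density `(2π)^{-n/2} e^{-|x|²/2}`
with respect to Lebesgue measure. -/
noncomputable def gaussianMeasure (n : ℕ) : Measure (EuclideanSpace ℝ (Fin n)) :=
  volume.withDensity fun x =>
    ENNReal.ofReal ((2 * Real.pi) ^ (-(n : ℝ) / 2) * Real.exp (-‖x‖ ^ 2 / 2))

open scoped ENNReal Pointwise

/-- One-dimensional Brunn–Minkowski, two compact sets. -/
lemma bm_two (A B : Set ℝ) (hA : IsCompact A) (hB : IsCompact B) (hA0 : A.Nonempty)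
    (hB0 : B.Nonempty) : volume A + volume B ≤ volume (A + B) := by
  obtain ⟨a, haA, ha⟩ := hA.exists_isGreatest hA0
  obtain ⟨b, hbB, hb⟩ := hB.exists_isLeast hB0
  have h1 : volume (Set.image (fun x => b + x) A) = volume A := by
    simp
  have h2 : volume (Set.image (fun x => a + x) B) = volume B := by
    simp
  have h3 : Set.image (fun x => b + x) A ∪ Set.image (fun x => a + x) B ⊆ A + B := by
    rintro x (⟨y, hy, rfl⟩ | ⟨y, hy, rfl⟩)
    · exact ⟨y, hy, b, hbB, by simp [add_comm]⟩
    · exact ⟨a, haA, y, hy, rfl⟩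
  have hm : MeasurableSet (Set.image (fun x => a + x) B) :=
    (hB.image (by fun_prop)).measurableSet
  have hd : AEDisjoint volume (Set.image (fun x => b + x) A) (Set.image (fun x => a + x) B) := by
    refine measure_mono_null (t := {a + b}) ?_ (by simp)
    rintro x ⟨⟨y, hy, rfl⟩, ⟨z, hz, hzx⟩⟩
    have := ha hy
    have := hb hz
    simp only at hzx
    simp only [Set.mem_singleton_iff]
    linarith
  calc volume A + volume B
      = volume (Set.image (fun x => b + x) A ∪ Set.image (fun x => a + x) B) := by
        rw [measure_union₀ hm.nullMeasurableSet hd, h1, h2]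
    _ ≤ _ := measure_mono h3

lemma bm_sum {ι : Type*} (s : Finset ι) (A : ι → Set ℝ) (hA : ∀ i, IsCompact (A i))
    (hA0 : ∀ i, (A i).Nonempty) :
    IsCompact (∑ i ∈ s, A i) ∧ (∑ i ∈ s, A i).Nonempty ∧
      ∑ i ∈ s, volume (A i) ≤ volume (∑ i ∈ s, A i) := by
  classical
  induction s using Finset.induction_on with
  | empty => simp
  | insert i s hi ih =>
    obtain ⟨h1, h2, h3⟩ := ih
    rw [Finset.sum_insert hi, Finset.sum_insert hi]
    exact ⟨(hA i).add h1, (hA0 i).add h2,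
      (add_le_add_right h3 _).trans (bm_two _ _ (hA i) h1 (hA0 i) h2)⟩

/-- Weighted Brunn–Minkowski on the line for measurable nonempty sets. -/
lemma bm_weighted {k : ℕ} (lam : Fin k → ℝ) (hl : ∀ i, 0 < lam i) (A : Fin k → Set ℝ)
    (hA : ∀ i, MeasurableSet (A i)) (hA0 : ∀ i, (A i).Nonempty) (S : Set ℝ)
    (hS : ∀ x : Fin k → ℝ, (∀ i, x i ∈ A i) → ∑ i, lam i * x i ∈ S) :
    ∑ i, ENNReal.ofReal (lam i) * volume (A i) ≤ volume S := by
  have key : ∀ K : Fin k → Set ℝ, (∀ i, K i ⊆ A i ∧ IsCompact (K i)) →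
      ∑ i, ENNReal.ofReal (lam i) * volume (K i) ≤ volume S := by
    intro K hK
    choose a ha using hA0
    have hc : ∀ i, IsCompact (lam i • insert (a i) (K i)) := fun i =>
      ((hK i).2.insert (a i)).smul (lam i)
    have h0 : ∀ i, (lam i • insert (a i) (K i)).Nonempty := fun i =>
      (Set.insert_nonempty _ _).smul_set
    obtain ⟨-, -, h⟩ := bm_sum Finset.univ _ hc h0
    calc _ ≤ ∑ i, volume (lam i • insert (a i) (K i)) := by
          refine Finset.sum_le_sum fun i _ => ?_
          rw [Measure.addHaar_smul]
          simp only [Module.finrank_self, pow_one, abs_of_pos (hl i)]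
          gcongr
          exact Set.subset_insert _ _
      _ ≤ _ := h
      _ ≤ _ := by
          refine measure_mono fun y hy => ?_
          rw [Set.mem_fintype_sum] at hy
          obtain ⟨g, hg, rfl⟩ := hy
          choose x hx hxg using hg
          simp only [smul_eq_mul] at hxg
          simp_rw [← hxg]
          refine hS x fun i => ?_
          rcases hx i with h | h
          · rw [h]; exact ha i
          · exact (hK i).1 h
  -- pass to the supremum
  have hseq : ∀ i, ∃ u : ℕ → Set ℝ, (∀ m, u m ⊆ A i ∧ IsCompact (u m)) ∧
      Filter.Tendsto (fun m => volume (u m)) Filter.atTop (nhds (volume (A i))) := by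
    intro i
    have := (hA i).measure_eq_iSup_isCompact (μ := volume)
    obtain ⟨v, -, hv, hv'⟩ := exists_seq_tendsto_sSup
      (S := {x | ∃ K, (K ⊆ A i ∧ IsCompact K) ∧ volume K = x})
      ⟨_, ∅, ⟨Set.empty_subset _, isCompact_empty⟩, rfl⟩ (OrderTop.bddAbove _)
    choose u hu hu' using hv'
    refine ⟨u, hu, ?_⟩
    simp_rw [hu']
    convert hv using 2
    rw [this]
    apply le_antisymm
    · exact iSup_le fun K => iSup_le fun h1 => iSup_le fun h2 => le_sSup ⟨K, ⟨h1, h2⟩, rfl⟩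
    · refine sSup_le ?_
      rintro x ⟨K, ⟨h1, h2⟩, rfl⟩
      exact le_iSup_of_le K (le_iSup_of_le h1 (le_iSup_of_le h2 le_rfl))
  choose u hu hu' using hseq
  refine le_of_tendsto' (f := fun m => ∑ i, ENNReal.ofReal (lam i) * volume (u i m)) (x := Filter.atTop) ?_
    fun m => key (fun i => u i m) fun i => hu i m
  exact tendsto_finsetSum _ fun i _ => ENNReal.Tendsto.const_mul (hu' i) (Or.inr ENNReal.ofReal_ne_top)

/-- Layer cake. -/
lemma layer (f : ℝ → ℝ≥0∞) (hf : Measurable f) :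
    ∫⁻ x, f x = ∫⁻ t in Set.Ioi (0 : ℝ), volume {x | ENNReal.ofReal t ≤ f x} := by
  have hm : MeasurableSet {p : ℝ × ℝ | ENNReal.ofReal p.2 ≤ f p.1} :=
    measurableSet_le (by fun_prop) (by fun_prop)
  have h1 : ∀ c : ℝ≥0∞, c = ∫⁻ t in Set.Ioi (0 : ℝ), ({t : ℝ | ENNReal.ofReal t ≤ c}.indicator 1 t : ℝ≥0∞) := by
    intro c
    have hmc : MeasurableSet {t : ℝ | ENNReal.ofReal t ≤ c} := measurableSet_le (by fun_prop) (by fun_prop)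
    rw [lintegral_indicator_one hmc, Measure.restrict_apply hmc]
    by_cases hc : c = ⊤
    · simp [hc]
    · have : {t : ℝ | ENNReal.ofReal t ≤ c} ∩ Set.Ioi 0 = Set.Ioc 0 c.toReal := by
        ext t
        simp only [Set.mem_inter_iff, Set.mem_ofPred_eq, Set.mem_Ioi, Set.mem_Ioc]
        rw [ENNReal.ofReal_le_iff_le_toReal hc]
        tauto
      rw [this]; simp [hc]
  calc ∫⁻ x, f x = ∫⁻ x, ∫⁻ t in Set.Ioi (0 : ℝ), ({p : ℝ × ℝ | ENNReal.ofReal p.2 ≤ f p.1}.indicator 1 (x, t) : ℝ≥0∞) := by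
        refine lintegral_congr fun x => ?_
        exact h1 (f x)
    _ = ∫⁻ t in Set.Ioi (0 : ℝ), ∫⁻ x, ({p : ℝ × ℝ | ENNReal.ofReal p.2 ≤ f p.1}.indicator 1 (x, t) : ℝ≥0∞) := by
        refine lintegral_lintegral_swap ?_
        exact (Measurable.indicator measurable_one hm).aemeasurable
    _ = _ := by
        refine lintegral_congr fun t => ?_
        have hmt : MeasurableSet {x | ENNReal.ofReal t ≤ f x} := measurableSet_le (by fun_prop) (by fun_prop)
        rw [← lintegral_indicator_one hmt]
        rfl

lemma amgm {k : ℕ} (lam : Fin k → ℝ) (hl : ∀ i, 0 < lam i) (hs : ∑ i, lam i = 1)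
    (a : Fin k → ℝ≥0∞) : ∏ i, a i ^ lam i ≤ ∑ i, ENNReal.ofReal (lam i) * a i := by
  by_cases h : ∃ i, a i = ⊤
  · obtain ⟨i, hi⟩ := h
    have : ∑ i, ENNReal.ofReal (lam i) * a i = ⊤ := by
      refine ENNReal.sum_eq_top.2 ⟨i, Finset.mem_univ _, ?_⟩
      rw [hi, ENNReal.mul_top]
      simpa using hl i
    rw [this]; exact le_top
  · push Not at h
    lift a to Fin k → NNReal using h
    have := NNReal.geom_mean_le_arith_mean_weighted Finset.univ (fun i => (lam i).toNNReal) a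
      (by rw [← Real.toNNReal_sum_of_nonneg (fun i _ => (hl i).le), hs]; simp)
    have h2 := ENNReal.coe_le_coe.2 this
    push_cast at h2
    convert h2 using 2 with i _ i _
    · rw [Real.coe_toNNReal _ (hl i).le, ENNReal.coe_rpow_of_nonneg _ (hl i).le]
    · rfl

lemma prod_tendsto {ι : Type*} (s : Finset ι) (a : ι → ℕ → ℝ≥0∞) (A : ι → ℝ≥0∞)
    (hA : ∀ i, A i ≠ 0) (h : ∀ i, Filter.Tendsto (a i) Filter.atTop (nhds (A i))) :
    Filter.Tendsto (fun m => ∏ i ∈ s, a i m) Filter.atTop (nhds (∏ i ∈ s, A i)) := by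
  classical
  induction s using Finset.induction_on with
  | empty => simp
  | insert i s hi ih =>
    simp_rw [Finset.prod_insert hi]
    exact ENNReal.Tendsto.mul (h i) (Or.inl (hA i)) ih (Or.inl (Finset.prod_ne_zero_iff.2 fun i _ => hA i))

lemma prod_const_rpow {k : ℕ} (lam : Fin k → ℝ) (hl : ∀ i, 0 < lam i) (hs : ∑ i, lam i = 1)
    (c : ℝ≥0∞) : ∏ i, c ^ lam i = c := by
  have : ∀ s : Finset (Fin k), ∏ i ∈ s, c ^ lam i = c ^ (∑ i ∈ s, lam i) := by
    intro s
    induction s using Finset.induction_on with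
    | empty => simp
    | insert i s hi ih =>
      rw [Finset.prod_insert hi, Finset.sum_insert hi, ih,
        ENNReal.rpow_add_of_nonneg _ _ (hl i).le (Finset.sum_nonneg fun i _ => (hl i).le)]
  rw [this, hs, ENNReal.rpow_one]

/-- Prékopa–Leindler on the line, normalised. -/
lemma pl_norm {k : ℕ} (lam : Fin k → ℝ) (hl : ∀ i, 0 < lam i) (hs : ∑ i, lam i = 1)
    (f : Fin k → ℝ → ℝ≥0∞) (hf : ∀ i, Measurable (f i)) (h : ℝ → ℝ≥0∞) (hh : Measurable h)
    (hfs : ∀ i, ⨆ x, f i x = 1)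
    (H : ∀ x : Fin k → ℝ, ∏ i, f i (x i) ^ lam i ≤ h (∑ i, lam i * x i)) :
    ∏ i, (∫⁻ x, f i x) ^ lam i ≤ ∫⁻ x, h x := by
  refine (amgm lam hl hs _).trans ?_
  have hmeas : ∀ i, Measurable fun t : ℝ => volume {x | ENNReal.ofReal t ≤ f i x} := by
    intro i
    refine Antitone.measurable fun s t hst => measure_mono fun x hx => ?_
    exact (ENNReal.ofReal_le_ofReal hst).trans hx
  simp_rw [layer h hh, fun i => layer (f i) (hf i),
    fun i => (lintegral_const_mul (μ := volume.restrict (Set.Ioi (0 : ℝ))) (ENNReal.ofReal (lam i)) (hmeas i)).symm]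
  rw [← lintegral_finsetSum _ (fun i _ => (hmeas i).const_mul _)]
  refine lintegral_mono_ae ?_
  have hne : ∀ᵐ t ∂(volume.restrict (Set.Ioi (0 : ℝ))), t ≠ 1 :=
    ae_restrict_of_ae (Measure.ae_ne volume 1)
  filter_upwards [hne, ae_restrict_mem measurableSet_Ioi] with t ht1 ht0
  rcases lt_or_gt_of_ne ht1 with h1 | h1
  · refine bm_weighted lam hl _ (fun i => measurableSet_le (by fun_prop) (hf i)) ?_ _ ?_
    · intro i
      have : ENNReal.ofReal t < ⨆ x, f i x := by
        rw [hfs i]; exact ENNReal.ofReal_lt_one.2 h1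
      obtain ⟨x, hx⟩ := lt_iSup_iff.1 this
      exact ⟨x, hx.le⟩
    · intro x hx
      refine le_trans ?_ (H x)
      rw [← prod_const_rpow lam hl hs (ENNReal.ofReal t)]
      exact Finset.prod_le_prod' fun i _ => ENNReal.rpow_le_rpow (hx i) (hl i).le
  · have : ∀ i, {x | ENNReal.ofReal t ≤ f i x} = ∅ := by
      intro i
      ext x
      simp only [Set.mem_ofPred_eq, Set.mem_empty_iff_false, iff_false, not_le]
      refine lt_of_le_of_lt (le_iSup (f i) x) ?_
      rw [hfs i]; exact ENNReal.one_lt_ofReal.2 h1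
    simp [this]

lemma pl_bdd {k : ℕ} (lam : Fin k → ℝ) (hl : ∀ i, 0 < lam i) (hs : ∑ i, lam i = 1)
    (f : Fin k → ℝ → ℝ≥0∞) (hf : ∀ i, Measurable (f i)) (h : ℝ → ℝ≥0∞) (hh : Measurable h)
    (hfs : ∀ i, ⨆ x, f i x ≠ ⊤)
    (H : ∀ x : Fin k → ℝ, ∏ i, f i (x i) ^ lam i ≤ h (∑ i, lam i * x i)) :
    ∏ i, (∫⁻ x, f i x) ^ lam i ≤ ∫⁻ x, h x := by
  by_cases h0 : ∃ i, ⨆ x, f i x = 0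
  · obtain ⟨i, hi⟩ := h0
    have : ∫⁻ x, f i x = 0 := by
      have : ∀ x, f i x = 0 := fun x => le_antisymm (hi ▸ le_iSup (f i) x) bot_le
      simp [this]
    rw [Finset.prod_eq_zero (Finset.mem_univ i)]
    · exact bot_le
    · rw [this, ENNReal.zero_rpow_of_pos (hl i)]
  push Not at h0
  set M : Fin k → ℝ≥0∞ := fun i => ⨆ x, f i x with hM
  set P := ∏ i, M i ^ lam i with hP
  have hP0 : P ≠ 0 := Finset.prod_ne_zero_iff.2 fun i _ =>
    (ENNReal.rpow_pos (pos_iff_ne_zero.2 (h0 i)) (hfs i)).ne'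
  have hPt : P ≠ ⊤ := ENNReal.prod_ne_top fun i _ => ENNReal.rpow_ne_top_of_nonneg (hl i).le (hfs i)
  have hPinv : ∏ i, ((M i)⁻¹) ^ lam i = P⁻¹ := by
    refine ENNReal.eq_inv_of_mul_eq_one_left ?_
    rw [hP, ← Finset.prod_mul_distrib]
    refine Finset.prod_eq_one fun i _ => ?_
    rw [← ENNReal.mul_rpow_of_nonneg _ _ (hl i).le, ENNReal.inv_mul_cancel (h0 i) (hfs i),
      ENNReal.one_rpow]
  have := pl_norm lam hl hs (fun i x => (M i)⁻¹ * f i x) (fun i => (hf i).const_mul _)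
    (fun x => P⁻¹ * h x) (hh.const_mul _) (fun i => by
      rw [← ENNReal.mul_iSup]; exact ENNReal.inv_mul_cancel (h0 i) (hfs i)) (fun x => by
      simp_rw [fun i => ENNReal.mul_rpow_of_nonneg (M i)⁻¹ (f i (x i)) (hl i).le]
      rw [Finset.prod_mul_distrib, hPinv]
      exact mul_le_mul_right (H x) _)
  simp_rw [fun i => lintegral_const_mul (μ := volume) (M i)⁻¹ (hf i),
    lintegral_const_mul (μ := volume) P⁻¹ hh,
    fun i => ENNReal.mul_rpow_of_nonneg (M i)⁻¹ (∫⁻ x, f i x) (hl i).le] at this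
  rw [Finset.prod_mul_distrib, hPinv] at this
  exact (ENNReal.mul_le_mul_iff_right (ENNReal.inv_ne_zero.2 hPt) (ENNReal.inv_ne_top.2 hP0)).1 this

/-- Prékopa–Leindler on the line. -/
lemma pl_one {k : ℕ} (lam : Fin k → ℝ) (hl : ∀ i, 0 < lam i) (hs : ∑ i, lam i = 1)
    (f : Fin k → ℝ → ℝ≥0∞) (hf : ∀ i, Measurable (f i)) (h : ℝ → ℝ≥0∞) (hh : Measurable h)
    (H : ∀ x : Fin k → ℝ, ∏ i, f i (x i) ^ lam i ≤ h (∑ i, lam i * x i)) :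
    ∏ i, (∫⁻ x, f i x) ^ lam i ≤ ∫⁻ x, h x := by
  by_cases h0 : ∃ i, ∫⁻ x, f i x = 0
  · obtain ⟨i, hi⟩ := h0
    rw [Finset.prod_eq_zero (Finset.mem_univ i)]
    · exact bot_le
    · rw [hi, ENNReal.zero_rpow_of_pos (hl i)]
  push Not at h0
  have hb : ∀ m : ℕ, ∏ i, (∫⁻ x, min (f i x) m) ^ lam i ≤ ∫⁻ x, h x := by
    intro m
    refine pl_bdd lam hl hs (fun i x => min (f i x) m) (fun i => (hf i).min measurable_const) h hh
      (fun i => ?_) fun x => le_trans ?_ (H x)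
    · exact ne_top_of_le_ne_top (ENNReal.natCast_ne_top m) (iSup_le fun x => min_le_right _ _)
    · exact Finset.prod_le_prod' fun i _ => ENNReal.rpow_le_rpow (min_le_left _ _) (hl i).le
  refine le_of_tendsto' (x := Filter.atTop) (prod_tendsto _ _ _ ?_ ?_) hb
  · intro i
    simp [ENNReal.rpow_eq_zero_iff, h0 i, (hl i).le, not_lt]
  · intro i
    refine Filter.Tendsto.ennrpow_const _ ?_
    refine lintegral_tendsto_of_tendsto_of_monotone
      (fun m => ((hf i).min measurable_const).aemeasurable) ?_ ?_
    · refine Filter.Eventually.of_forall fun x a b hab => ?_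
      exact min_le_min_left _ (by exact_mod_cast hab)
    · refine Filter.Eventually.of_forall fun x => ?_
      have : Filter.Tendsto (fun m : ℕ => min (f i x) (m : ℝ≥0∞)) Filter.atTop (nhds (min (f i x) ⊤)) :=
        tendsto_const_nhds.min ENNReal.tendsto_nat_nhds_top
      simpa using this

/-- Prékopa–Leindler on `Fin n → ℝ`. -/
lemma pl_pi {k : ℕ} (lam : Fin k → ℝ) (hl : ∀ i, 0 < lam i) (hs : ∑ i, lam i = 1) (n : ℕ)
    (f : Fin k → (Fin n → ℝ) → ℝ≥0∞) (hf : ∀ i, Measurable (f i)) (h : (Fin n → ℝ) → ℝ≥0∞)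
    (hh : Measurable h)
    (H : ∀ x : Fin k → (Fin n → ℝ), ∏ i, f i (x i) ^ lam i ≤ h (∑ i, lam i • x i)) :
    ∏ i, (∫⁻ x, f i x) ^ lam i ≤ ∫⁻ x, h x := by
  induction n with
  | zero =>
    have e : ∀ g : (Fin 0 → ℝ) → ℝ≥0∞, ∫⁻ x, g x = g 0 := by
      intro g
      rw [lintegral_unique]
      have : volume (Set.univ : Set (Fin 0 → ℝ)) = 1 := by simp [volume_pi]
      rw [this, mul_one]; exact congrArg g (Subsingleton.elim _ _)
    simp_rw [e]
    refine (H 0).trans (le_of_eq ?_)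
    congr 1
    exact Subsingleton.elim _ _
  | succ n ih =>
    have mp := (volume_preserving_piFinSuccAbove (fun _ : Fin (n + 1) => ℝ) 0).symm
    have mc : Measurable fun p : ℝ × (Fin n → ℝ) => (Fin.cons p.1 p.2 : Fin (n + 1) → ℝ) := by
      refine measurable_pi_lambda _ fun j => ?_
      refine Fin.cases ?_ (fun j => ?_) j
      · simpa using measurable_fst
      · simp only [Fin.cons_succ]; fun_prop
    have e : ∀ g : (Fin (n + 1) → ℝ) → ℝ≥0∞, Measurable g →
        ∫⁻ x, g x = ∫⁻ t : ℝ, ∫⁻ y : Fin n → ℝ, g (Fin.cons t y) := by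
      intro g hg
      rw [← mp.lintegral_comp hg, Measure.volume_eq_prod]
      refine (lintegral_prod _ (hg.comp mp.measurable).aemeasurable).trans ?_
      refine lintegral_congr fun t => lintegral_congr fun y => congrArg g ?_
      exact Fin.insertNth_zero (α := fun _ => ℝ) t y
    simp_rw [fun i => e (f i) (hf i), e h hh]
    have mm : ∀ g : (Fin (n + 1) → ℝ) → ℝ≥0∞, Measurable g →
        Measurable fun t : ℝ => ∫⁻ y : Fin n → ℝ, g (Fin.cons t y) := fun g hg =>
      (hg.comp mc).lintegral_prod_right'
    refine pl_one lam hl hs _ (fun i => mm _ (hf i)) _ (mm _ hh) fun t => ?_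
    have mt : ∀ t : ℝ, Measurable fun y : Fin n → ℝ => (Fin.cons t y : Fin (n + 1) → ℝ) := fun t =>
      mc.comp (measurable_const.prodMk measurable_id)
    refine ih (fun i y => f i (Fin.cons (t i) y)) (fun i => (hf i).comp (mt _))
      (fun y => h (Fin.cons (∑ i, lam i * t i) y)) (hh.comp (mt _)) fun x => ?_
    refine (H fun i => Fin.cons (t i) (x i)).trans (le_of_eq ?_)
    congr 1
    ext j
    refine Fin.cases ?_ (fun j => ?_) j <;> simp

/-- Prékopa–Leindler on Euclidean space. -/
lemma pl_euclid {k : ℕ} (lam : Fin k → ℝ) (hl : ∀ i, 0 < lam i) (hs : ∑ i, lam i = 1) (n : ℕ)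
    (f : Fin k → EuclideanSpace ℝ (Fin n) → ℝ≥0∞) (hf : ∀ i, Measurable (f i))
    (h : EuclideanSpace ℝ (Fin n) → ℝ≥0∞) (hh : Measurable h)
    (H : ∀ x : Fin k → EuclideanSpace ℝ (Fin n),
      ∏ i, f i (x i) ^ lam i ≤ h (∑ i, lam i • x i)) :
    ∏ i, (∫⁻ x, f i x) ^ lam i ≤ ∫⁻ x, h x := by
  have mp := PiLp.volume_preserving_toLp (Fin n)
  simp_rw [fun i => (mp.lintegral_comp (hf i)).symm, (mp.lintegral_comp hh).symm]
  refine pl_pi lam hl hs n _ (fun i => (hf i).comp mp.measurable) _ (hh.comp mp.measurable)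
    fun x => ?_
  refine (H fun i => WithLp.toLp 2 (x i)).trans (le_of_eq ?_)
  congr 1
  ext j
  simp

/-- The weighted Euclidean form. -/
lemma weak_bs_core {k : ℕ} (lam : Fin k → ℝ) (hl : ∀ i, 0 < lam i) (hs : ∑ i, lam i = 1) (n : ℕ)
    (V : Fin k → EuclideanSpace ℝ (Fin n) → ℝ) (hV : ∀ i, Measurable (V i))
    (hi : ∀ i, Integrable (fun x => Real.exp (-(V i x))))
    (H : ∀ x : Fin k → EuclideanSpace ℝ (Fin n),
      (1 / 2) * ‖∑ j, lam j • x j‖ ^ 2 ≤ ∑ i, lam i * V i (x i)) :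
    ∏ i, (∫ x, Real.exp (-(V i x))) ^ lam i ≤ (2 * Real.pi) ^ ((n : ℝ) / 2) := by
  have hg : ∫ x : EuclideanSpace ℝ (Fin n), Real.exp (-(1/2) * ‖x‖ ^ 2) = (2 * Real.pi) ^ ((n : ℝ) / 2) := by
    rw [GaussianFourier.integral_rexp_neg_mul_sq_norm (by norm_num)]
    simp [mul_comm]
  have hgi : Integrable fun x : EuclideanSpace ℝ (Fin n) => Real.exp (-(1/2) * ‖x‖ ^ 2) := by
    by_contra hc
    rw [integral_undef hc] at hg
    have : 0 < (2 * Real.pi) ^ ((n : ℝ) / 2) := by positivity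
    linarith
  have := pl_euclid lam hl hs n (fun i x => ENNReal.ofReal (Real.exp (-(V i x))))
    (fun i => by have := hV i; fun_prop) (fun x => ENNReal.ofReal (Real.exp (-(1/2) * ‖x‖ ^ 2)))
    (by fun_prop) (fun x => by
      simp_rw [fun i => ENNReal.ofReal_rpow_of_pos (p := lam i) (Real.exp_pos (-(V i (x i))))]
      rw [← ENNReal.ofReal_prod_of_nonneg (fun i _ => by positivity)]
      refine ENNReal.ofReal_le_ofReal ?_
      simp_rw [← Real.exp_mul]
      rw [← Real.exp_sum, Real.exp_le_exp]
      have h2 := H x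
      have : ∑ i, -V i (x i) * lam i = - ∑ i, lam i * V i (x i) := by
        rw [← Finset.sum_neg_distrib]
        exact Finset.sum_congr rfl fun i _ => by ring
      rw [this]; linarith)
  simp_rw [fun i => (ofReal_integral_eq_lintegral_ofReal (hi i)
      (Filter.Eventually.of_forall fun x => (Real.exp_pos _).le)).symm,
    (ofReal_integral_eq_lintegral_ofReal hgi
      (Filter.Eventually.of_forall fun x => (Real.exp_pos _).le)).symm] at this
  have hn : ∀ i, 0 ≤ ∫ x, Real.exp (-(V i x)) := fun i => integral_nonneg fun x => (Real.exp_pos _).le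
  simp_rw [fun i => ENNReal.ofReal_rpow_of_nonneg (p := lam i) (hn i) (hl i).le] at this
  rw [← ENNReal.ofReal_prod_of_nonneg (fun i _ => Real.rpow_nonneg (hn i) _), hg] at this
  exact (ENNReal.ofReal_le_ofReal_iff (by positivity)).1 this

/-- Gaussian form and Euclidean form of a weak Blaschke–Santaló-type inequality
(no symmetry assumption): if `∑ λ_i F_i(x_i) ≤ (1/2)(∑ λ_i |x_i|² - |∑ λ_j x_j|²)`
then `∏ (∫ e^{F_i} dγ)^{λ_i} ≤ 1`; equivalently, if
`∑ V_i(x_i) ≥ (1/(2k))|x_1 + ⋯ + x_k|²` then `∏ ∫ e^{-V_i} dx ≤ (2π)^{kn/2}`. -/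
theorem weak_BS_gaussian_and_euclidean (n k : ℕ) (hk : 2 ≤ k) :
    (∀ lam : Fin k → ℝ, (∀ i, lam i ∈ Set.Ioo (0 : ℝ) 1) → (∑ i : Fin k, lam i = 1) →
      ∀ F : Fin k → EuclideanSpace ℝ (Fin n) → ℝ,
        (∀ i, Measurable (F i)) →
        (∀ i, Integrable (fun x => Real.exp (F i x)) (gaussianMeasure n)) →
        (∀ x : Fin k → EuclideanSpace ℝ (Fin n),
          ∑ i : Fin k, lam i * F i (x i)
            ≤ (1 / 2) * ((∑ i : Fin k, lam i * ‖x i‖ ^ 2)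
                - ‖∑ j : Fin k, lam j • x j‖ ^ 2)) →
        ∏ i : Fin k, (∫ x, Real.exp (F i x) ∂(gaussianMeasure n)) ^ (lam i) ≤ 1)
    ∧ (∀ V : Fin k → EuclideanSpace ℝ (Fin n) → ℝ,
        (∀ i, Measurable (V i)) →
        (∀ i, Integrable (fun x : EuclideanSpace ℝ (Fin n) => Real.exp (-(V i x)))) →
        (∀ x : Fin k → EuclideanSpace ℝ (Fin n),
          (1 / (2 * (k : ℝ))) * ‖∑ i : Fin k, x i‖ ^ 2 ≤ ∑ i : Fin k, V i (x i)) →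
        ∏ i : Fin k, (∫ x : EuclideanSpace ℝ (Fin n), Real.exp (-(V i x)))
          ≤ (2 * Real.pi) ^ (((k : ℝ) * (n : ℝ)) / 2)) := by
  refine ⟨?_, ?_⟩
  · intro lam hl hs F hF hi H
    set c : ℝ := (2 * Real.pi) ^ (-(n : ℝ) / 2) with hc
    have hc0 : 0 < c := by positivity
    have hd : Measurable fun x : EuclideanSpace ℝ (Fin n) => c * Real.exp (-‖x‖ ^ 2 / 2) := by
      fun_prop
    have e1 : ∀ i x, (c * Real.exp (-‖x‖ ^ 2 / 2)) * Real.exp (F i x)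
        = c * Real.exp (-(‖x‖ ^ 2 / 2 - F i x)) := by
      intro i x
      rw [mul_assoc, ← Real.exp_add]
      congr 2
      ring
    have hlt : ∀ᵐ x : EuclideanSpace ℝ (Fin n),
        ENNReal.ofReal (c * Real.exp (-‖x‖ ^ 2 / 2)) < ⊤ :=
      Filter.Eventually.of_forall fun x => ENNReal.ofReal_lt_top
    have tr : ∀ x : EuclideanSpace ℝ (Fin n),
        (ENNReal.ofReal (c * Real.exp (-‖x‖ ^ 2 / 2))).toReal = c * Real.exp (-‖x‖ ^ 2 / 2) :=
      fun x => ENNReal.toReal_ofReal (by positivity)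
    have hi' : ∀ i, Integrable (fun x : EuclideanSpace ℝ (Fin n) =>
        Real.exp (-(‖x‖ ^ 2 / 2 - F i x))) := by
      intro i
      have h1 := hi i
      unfold gaussianMeasure at h1
      rw [integrable_withDensity_iff_integrable_smul' hd.ennreal_ofReal hlt] at h1
      simp_rw [tr, smul_eq_mul, e1] at h1
      exact (integrable_const_mul_iff hc0.ne'.isUnit _).1 h1
    have hint : ∀ i, ∫ x, Real.exp (F i x) ∂(gaussianMeasure n)
        = c * ∫ x : EuclideanSpace ℝ (Fin n), Real.exp (-(‖x‖ ^ 2 / 2 - F i x)) := by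
      intro i
      unfold gaussianMeasure
      rw [integral_withDensity_eq_integral_toReal_smul hd.ennreal_ofReal hlt]
      simp_rw [tr, smul_eq_mul, e1]
      rw [integral_const_mul]
    have core := weak_bs_core lam (fun i => (hl i).1) hs n (fun i x => ‖x‖ ^ 2 / 2 - F i x)
      (fun i => by have := hF i; fun_prop) hi' (fun x => by
        have h1 := H x
        have h2 : ∑ i, lam i * (‖x i‖ ^ 2 / 2 - F i (x i))
            = (1 / 2) * (∑ i, lam i * ‖x i‖ ^ 2) - ∑ i, lam i * F i (x i) := by
          rw [Finset.mul_sum, ← Finset.sum_sub_distrib]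
          exact Finset.sum_congr rfl fun i _ => by ring
        rw [h2]
        linarith)
    simp_rw [hint]
    rw [Finset.prod_congr rfl fun i _ => Real.mul_rpow hc0.le
      (integral_nonneg fun x => (Real.exp_pos _).le), Finset.prod_mul_distrib,
      ← Real.rpow_sum_of_pos hc0, hs, Real.rpow_one]
    calc _ ≤ c * (2 * Real.pi) ^ ((n : ℝ) / 2) := by gcongr
      _ = 1 := by
        rw [hc, ← Real.rpow_add (by positivity)]
        ring_nf
        simp
  · intro V hV hi H
    have hk0 : (0 : ℝ) < k := by exact_mod_cast (by omega : 0 < k)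
    have core := weak_bs_core (fun _ : Fin k => (1 / (k : ℝ))) (fun i => by positivity)
      (by simp [hk0.ne']) n V hV hi (fun x => by
        have h1 := H x
        rw [← Finset.smul_sum, ← Finset.mul_sum, norm_smul, Real.norm_of_nonneg (by positivity)]
        calc _ = (1 / (k : ℝ)) * ((1 / (2 * (k : ℝ))) * ‖∑ i : Fin k, x i‖ ^ 2) := by ring
          _ ≤ _ := by gcongr)
    have hn : ∀ i, 0 ≤ ∫ x, Real.exp (-(V i x)) :=
      fun i => integral_nonneg fun x => (Real.exp_pos _).le
    rw [Real.finsetProd_rpow _ _ (fun i _ => hn i)] at core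
    have hp : 0 ≤ ∏ i, ∫ x, Real.exp (-(V i x)) := Finset.prod_nonneg fun i _ => hn i
    have h3 := Real.rpow_le_rpow (by positivity) core hk0.le
    rw [← Real.rpow_mul hp, ← Real.rpow_mul (by positivity), one_div_mul_cancel hk0.ne',
      Real.rpow_one] at h3
    convert h3 using 2
    ring
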